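/- arXiv:0902.3440 — 2 statements merged into one kernel-verified Lean document; each statement's English description precedes it below -/
import Mathlib

section
/- Let K be a field of characteristic zero and let i, j be positive integers with gcd(i, j) = 1. Then the polynomial T_i(y) − T_j(x), regarded as an element of the polynomial ring K[x, y] (e.g., of MvPolynomial (Fin 2) K, with T_i evaluated at the variable y and T_j at the variable x), is irreducible. -/
open Polynomial Polynomial.Chebyshev

lemma aux_zero (K : Type*) [Field K] [CharZero K]
    (i j : ℕ) (hi : 0 < i) (hj : 0 < j) (hgcd : Nat.gcd i j = 1) (A : K[X][X])
    (hA : A.natDegree < j)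
    (h : A.eval₂ (Polynomial.compRingHom (T K j)) (T K i) = 0) : A = 0 := by
  by_contra hne
  rw [eval₂_eq_sum, Polynomial.sum_def] at h
  have hTi : (T K i).natDegree = i := by simp
  have hTj : (T K j).natDegree = j := by simp
  have hTi0 : T K i ≠ 0 := T_ne_zero K i
  have key : ∀ k ∈ A.support,
      ((compRingHom (T K j)) (A.coeff k) * T K i ^ k).degree
        = ((j * (A.coeff k).natDegree + i * k : ℕ) : WithBot ℕ) := by
    intro k hk
    have h0 : (A.coeff k).comp (T K j) ≠ 0 := by
      intro h1
      rw [comp_eq_zero_iff] at h1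
      rcases h1 with h1 | ⟨_, h1⟩
      · exact (mem_support_iff.mp hk) h1
      · rw [h1, natDegree_C] at hTj
        omega
    change ((A.coeff k).comp (T K j) * T K i ^ k).degree = _
    rw [degree_eq_natDegree (mul_ne_zero h0 (pow_ne_zero _ hTi0)),
      natDegree_mul h0 (pow_ne_zero _ hTi0), natDegree_comp, natDegree_pow, hTi, hTj]
    congr 1
    ring
  have hd := degree_sum_eq_of_disjoint
    (fun k => (compRingHom (T K j)) (A.coeff k) * T K i ^ k) A.support (by
      rintro k ⟨hk, -⟩ l ⟨hl, -⟩ hkl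
      simp only [Function.onFun, Function.comp]
      rw [key k hk, key l hl]
      intro heq
      apply hkl
      have heq' : j * (A.coeff k).natDegree + i * k = j * (A.coeff l).natDegree + i * l := by
        exact_mod_cast heq
      have hm : i * k ≡ i * l [MOD j] := by
        have : (j * (A.coeff k).natDegree + i * k) % j
          = (j * (A.coeff l).natDegree + i * l) % j := by rw [heq']
        simpa [Nat.ModEq, Nat.mul_add_mod] using this
      have hm2 := Nat.ModEq.cancel_left_of_coprime (by rw [Nat.gcd_comm]; exact hgcd) hm
      exact Nat.ModEq.eq_of_lt_of_lt hm2 ((le_natDegree_of_mem_supp k hk).trans_lt hA)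
        ((le_natDegree_of_mem_supp l hl).trans_lt hA))
  rw [h, degree_zero] at hd
  have hmem := natDegree_mem_support_of_nonzero hne
  have := Finset.le_sup
    (f := fun k => ((compRingHom (T K j)) (A.coeff k) * T K i ^ k).degree) hmem
  simp only [key _ hmem] at this
  rw [← hd] at this
  exact WithBot.coe_ne_bot (le_bot_iff.mp this)

lemma aux_irr (K : Type*) [Field K] [CharZero K]
    (i j : ℕ) (hi : 0 < i) (hj : 0 < j) (hgcd : Nat.gcd i j = 1) :
    Irreducible (Polynomial.C (T K i) - (T K j).map Polynomial.C) := by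
  set F : K[X][X] := Polynomial.C (T K i) - (T K j).map Polynomial.C with hF
  have hFd : F.natDegree = j := by
    rw [hF, ← natDegree_neg, neg_sub, natDegree_sub_C, natDegree_map_eq_of_injective C_injective]
    simp
  have hFl : IsUnit F.leadingCoeff := by
    have hj' : (j : ℤ).natAbs = j := by simp
    have h2 := leadingCoeff_T K (j : ℤ)
    rw [leadingCoeff, natDegree_T, hj'] at h2
    rw [leadingCoeff, hFd, hF, coeff_sub, coeff_C, if_neg hj.ne', coeff_map, h2, zero_sub]
    refine IsUnit.neg ?_
    rw [isUnit_C]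
    simp
  have hF0 : F ≠ 0 := by
    intro h0
    rw [h0] at hFd
    simp at hFd
    omega
  have hroot : F.eval₂ (compRingHom (T K j)) (T K i) = 0 := by
    rw [hF, eval₂_sub, eval₂_C, eval₂_map]
    change (T K i).comp (T K j) - _ = 0
    have : (compRingHom (T K j)).comp (Polynomial.C : K →+* K[X]) = Polynomial.C := by
      ext; simp
    rw [this]
    change (T K i).comp (T K j) - (T K j).comp (T K i) = 0
    rw [← T_mul, ← T_mul, mul_comm, sub_self]
  have main : ∀ A B : K[X][X], F = A * B →
      A.eval₂ (compRingHom (T K j)) (T K i) = 0 → IsUnit B := by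
    intro A B hAB hA
    have hA0 : A ≠ 0 := by rintro rfl; simp [hAB] at hF0
    have hB0 : B ≠ 0 := by rintro rfl; simp [hAB] at hF0
    have hle : j ≤ A.natDegree := by
      by_contra hlt
      exact hA0 (aux_zero K i j hi hj hgcd A (by omega) hA)
    have hdeg := natDegree_mul hA0 hB0
    rw [← hAB, hFd] at hdeg
    have hB : B.natDegree = 0 := by omega
    rw [hAB, leadingCoeff_mul] at hFl
    have hu := isUnit_of_mul_isUnit_right hFl
    rw [eq_C_of_natDegree_eq_zero hB]
    rw [leadingCoeff, hB] at hu
    exact isUnit_C.mpr hu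
  refine ⟨fun hu => ?_, fun A B hAB => ?_⟩
  · have := natDegree_eq_zero_of_isUnit hu
    omega
  · have h := hroot
    rw [hAB, eval₂_mul, mul_eq_zero] at h
    rcases h with h | h
    · exact Or.inr (main A B hAB h)
    · exact Or.inl (main B A (by rw [hAB, mul_comm]) h)

theorem chebyshev_curve_irreducible (K : Type*) [Field K] [CharZero K]
    (i j : ℕ) (hi : 0 < i) (hj : 0 < j) (hgcd : Nat.gcd i j = 1) :
    Irreducible
      (Polynomial.aeval (MvPolynomial.X 1 : MvPolynomial (Fin 2) K) (T K i) -
        Polynomial.aeval (MvPolynomial.X 0 : MvPolynomial (Fin 2) K) (T K j)) := by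
  let e : MvPolynomial (Fin 2) K ≃ₐ[K] K[X][X] :=
    (MvPolynomial.finSuccEquiv K 1).trans
      (Polynomial.mapAlgEquiv (MvPolynomial.uniqueAlgEquiv K (Fin 1)))
  have e0 : e (MvPolynomial.X 0) = Polynomial.X := by
    simp [e, MvPolynomial.finSuccEquiv_X_zero]
  have e1 : e (MvPolynomial.X 1) = Polynomial.C Polynomial.X := by
    have h := MvPolynomial.finSuccEquiv_X_succ (R := K) (n := 1) (j := 0)
    rw [Fin.succ_zero_eq_one] at h
    simp [e, h]
  rw [← MulEquiv.irreducible_iff e]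
  have h1 : ∀ p : K[X], aeval (Polynomial.C Polynomial.X : K[X][X]) p = Polynomial.C p := by
    intro p
    have := aeval_algebraMap_apply (K[X][X]) (Polynomial.X : K[X]) p
    rw [aeval_X_left_apply] at this
    exact this
  have h2 : ∀ p : K[X], aeval (Polynomial.X : K[X][X]) p = p.map Polynomial.C := by
    intro p
    rw [aeval_def, Polynomial.map]
    rfl
  have : e (Polynomial.aeval (MvPolynomial.X 1 : MvPolynomial (Fin 2) K) (T K i) -
        Polynomial.aeval (MvPolynomial.X 0 : MvPolynomial (Fin 2) K) (T K j))
      = Polynomial.C (T K i) - (T K j).map Polynomial.C := by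
    rw [map_sub, ← aeval_algHom_apply, ← aeval_algHom_apply, e0, e1, h1, h2]
  rw [this]
  exact aux_irr K i j hi hj hgcd
end

section
/- (Parity Property for Nodal Curves) Let f, g ∈ ℝ[t] and let α : ℝ → ℝ² be given by α(t) = (f(t), g(t)). Assume: (i) (f′(t), g′(t)) ≠ (0, 0) for all t ∈ ℝ; (ii) the set S of points of ℝ² having at least two α-preimages is finite with |S| = n, and every point of S has exactly two α-preimages; (iii) for every P ∈ S with preimages s ≠ s′, the velocity vectors (f′(s), g′(s)) and (f′(s′), g′(s′)) are linearly independent (every singularity is a node). Let t₁ < t₂ < ⋯ < t_{2n} be the elements of α⁻¹(S). Then whenever α(t_a) = α(t_b) with a ≠ b, the indices a and b have opposite parity (a + b is odd). -/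
open Polynomial

open Filter Topology in
lemma sign_near {h : ℝ → ℝ} {d u : ℝ} (hd : HasDerivAt h d u) (h0 : h u = 0) (hneg : d < 0) :
    ∀ᶠ t in 𝓝 u, (u < t → h t < 0) ∧ (t ≤ u → 0 ≤ h t) := by
  have h1 := hasDerivAt_iff_tendsto_slope.1 hd
  have h2 : ∀ᶠ t in 𝓝[≠] u, slope h u t < 0 := h1.eventually (gt_mem_nhds hneg)
  rw [eventually_nhdsWithin_iff] at h2
  filter_upwards [h2] with t ht
  rw [slope_def_field, h0, sub_zero] at ht
  constructor
  · intro hut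
    have := ht (by simpa using hut.ne')
    by_contra hc
    push Not at hc
    have : 0 ≤ h t / (t - u) := div_nonneg hc (by linarith)
    linarith
  · intro hut
    rcases hut.eq_or_lt with rfl | hlt
    · rw [h0]
    · have := ht (by simpa using hlt.ne)
      by_contra hc
      push Not at hc
      have : 0 ≤ h t / (t - u) := div_nonneg_of_nonpos hc.le (by linarith)
      linarith

open Filter Topology in
lemma avoid {γ γ' : ℝ → ℂ} (hγ : ∀ t, HasDerivAt γ (γ' t) t) {u₁ u₂ σ₁ σ₂ : ℝ}
    (hσ₁ : σ₁ * σ₁ = 1) (hσ₂ : σ₂ * σ₂ = 1) {p : ℂ} (h1 : γ u₁ = p) (h2 : γ u₂ = p)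
    (hD : (γ' u₁).re * (γ' u₂).im - (γ' u₁).im * (γ' u₂).re ≠ 0)
    {K : Set ℝ} (hK : IsCompact K) (hp : ∀ t ∈ K, γ t = p → t = u₁ ∨ t = u₂)
    (hK1 : ∀ᶠ t in 𝓝 u₁, t ∈ K → σ₁ * (t - u₁) ≤ 0)
    (hK2 : ∀ᶠ t in 𝓝 u₂, t ∈ K → σ₂ * (t - u₂) ≤ 0) :
    ∀ᶠ ε in 𝓝[>] (0:ℝ), ∀ t ∈ K, γ t ∉ segment ℝ (γ (u₁ + σ₁ * ε)) (γ (u₂ + σ₂ * ε)) := by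
  have hcont : Continuous γ := continuous_iff_continuousAt.2 fun t => (hγ t).continuousAt
  obtain ⟨x, y, hx1, hx2⟩ : ∃ x y : ℝ, x * (γ' u₁).re + y * (γ' u₁).im = -σ₁ ∧
      x * (γ' u₂).re + y * (γ' u₂).im = -σ₂ := by
    refine ⟨(-σ₁ * (γ' u₂).im + σ₂ * (γ' u₁).im) /
        ((γ' u₁).re * (γ' u₂).im - (γ' u₁).im * (γ' u₂).re),
      (σ₁ * (γ' u₂).re - σ₂ * (γ' u₁).re) /
        ((γ' u₁).re * (γ' u₂).im - (γ' u₁).im * (γ' u₂).re), ?_, ?_⟩ <;>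
      rw [div_mul_eq_mul_div, div_mul_eq_mul_div, ← add_div, div_eq_iff hD] <;> ring
  set l : ℂ → ℝ := fun z => x * z.re + y * z.im with hl
  have hder : ∀ t, HasDerivAt (fun t => l (γ t - p)) (l (γ' t)) t := by
    intro t
    have hr : HasDerivAt (fun t => (γ t).re) (γ' t).re t := by
      exact Complex.reCLM.hasFDerivAt.comp_hasDerivAt t (hγ t)
    have hi : HasDerivAt (fun t => (γ t).im) (γ' t).im t := by
      exact Complex.imCLM.hasFDerivAt.comp_hasDerivAt t (hγ t)
    exact ((hr.sub_const p.re).const_mul x).add ((hi.sub_const p.im).const_mul y)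
  have key : ∀ u σ : ℝ, σ * σ = 1 → γ u = p → l (γ' u) = -σ →
      (∀ᶠ t in 𝓝 u, t ∈ K → σ * (t - u) ≤ 0) →
      (∀ᶠ t in 𝓝 u, t ∈ K → 0 ≤ l (γ t - p)) ∧
      (∀ᶠ ε in 𝓝[>] (0:ℝ), l (γ (u + σ * ε) - p) < 0) := by
    intro u σ hσ hu hlu hKu
    have e : HasDerivAt (fun τ : ℝ => u + σ * τ) σ 0 := by
      simpa using ((hasDerivAt_id (0:ℝ)).const_mul σ).const_add u
    have d : HasDerivAt (fun τ => l (γ (u + σ * τ) - p)) (-1) 0 := by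
      have := HasDerivAt.comp (0:ℝ) (h₂ := fun t => l (γ t - p)) (h := fun τ : ℝ => u + σ * τ)
        (hder (u + σ * 0)) e
      simp only [mul_zero, add_zero, hlu] at this
      rw [neg_mul, hσ] at this
      exact this
    have s := sign_near d (by simp [hu, hl]) (by norm_num)
    constructor
    · have tt : Tendsto (fun t => σ * (t - u)) (𝓝 u) (𝓝 0) := by
        have : Continuous (fun t => σ * (t - u)) := by fun_prop
        simpa using this.tendsto u
      filter_upwards [tt.eventually s, hKu] with t ht hk htK
      have := ht.2 (hk htK)
      rwa [← mul_assoc, hσ, one_mul, add_sub_cancel] at this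
    · rw [eventually_nhdsWithin_iff]
      filter_upwards [s] with ε hε h
      exact hε.1 h
  obtain ⟨a1, b1⟩ := key u₁ σ₁ hσ₁ h1 hx1 hK1
  obtain ⟨a2, b2⟩ := key u₂ σ₂ hσ₂ h2 hx2 hK2
  obtain ⟨U1, hU1, o1, m1⟩ := eventually_nhds_iff.1 a1
  obtain ⟨U2, hU2, o2, m2⟩ := eventually_nhds_iff.1 a2
  have hK' : IsCompact (γ '' (K \ (U1 ∪ U2))) := (hK.diff (o1.union o2)).image hcont
  have hpn : p ∈ (γ '' (K \ (U1 ∪ U2)))ᶜ := by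
    rintro ⟨t, ⟨htK, htU⟩, htp⟩
    rcases hp t htK htp with rfl | rfl
    · exact htU (Or.inl m1)
    · exact htU (Or.inr m2)
  obtain ⟨η, hη, hball⟩ := Metric.isOpen_iff.1 hK'.isClosed.isOpen_compl p hpn
  have near : ∀ u σ : ℝ, γ u = p → ∀ᶠ ε in 𝓝[>] (0:ℝ), γ (u + σ * ε) ∈ Metric.ball p η := by
    intro u σ hu
    have : Continuous (fun ε => γ (u + σ * ε)) := by fun_prop
    have h := this.tendsto 0
    simp only [mul_zero, add_zero, hu] at h
    exact nhdsWithin_le_nhds (h.eventually (Metric.ball_mem_nhds p hη))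
  filter_upwards [b1, b2, near u₁ σ₁ h1, near u₂ σ₂ h2] with ε e1 e2 n1 n2 t htK hseg
  by_cases htU : t ∈ U1 ∪ U2
  · have hpos : 0 ≤ l (γ t - p) := by
      rcases htU with h | h
      · exact hU1 t h htK
      · exact hU2 t h htK
    obtain ⟨A, B, hA, hB, hAB, heq⟩ := hseg
    rw [← heq] at hpos
    have : l (A • γ (u₁ + σ₁ * ε) + B • γ (u₂ + σ₂ * ε) - p)
      = A * l (γ (u₁ + σ₁ * ε) - p) + B * l (γ (u₂ + σ₂ * ε) - p) := by
      have hB' : B = 1 - A := by linarith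
      subst hB'
      simp [hl]; ring
    rw [this] at hpos
    rcases hA.eq_or_lt with h | h
    · have : B = 1 := by linarith
      subst this; rw [← h] at hpos; linarith
    · nlinarith
  · have := (convex_ball p η).segment_subset n1 n2 hseg
    exact hball this ⟨t, ⟨htK, htU⟩, rfl⟩

lemma mem_slit {z q r : ℂ} (h : z ∉ segment ℝ q r) : (z - q) / (z - r) ∈ Complex.slitPlane := by
  by_contra hc
  apply h
  have hzr : z - r ≠ 0 := by
    intro h0
    apply h
    rw [sub_eq_zero.1 h0]
    exact right_mem_segment ℝ q r
  rw [Complex.mem_slitPlane_iff_not_le_zero, not_not] at hc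
  obtain ⟨c, hc0, hcz⟩ : ∃ c : ℝ, 0 ≤ c ∧ (z - q) / (z - r) = -(c : ℂ) := by
    refine ⟨-((z - q) / (z - r)).re, ?_, ?_⟩
    · have := (Complex.le_def.1 hc).1
      simp only [Complex.zero_re] at this
      linarith
    · apply Complex.ext
      · simp
      · simpa using (Complex.le_def.1 hc).2
  rw [div_eq_iff hzr] at hcz
  have h1 : (1 + c : ℂ) ≠ 0 := by
    have : (1 + c : ℝ) ≠ 0 := by linarith
    exact_mod_cast this
  refine ⟨1 / (1 + c), c / (1 + c), by positivity, by positivity, by field_simp, ?_⟩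
  simp only [Complex.real_smul]
  push_cast
  field_simp
  linear_combination -hcz

lemma int_ok {γ γ' : ℝ → ℂ} (hγ : ∀ t, HasDerivAt γ (γ' t) t) (hc : Continuous γ')
    {a b : ℝ} (hab : a ≤ b) {q : ℂ} (h : ∀ t ∈ Set.Icc a b, γ t ≠ q) :
    IntervalIntegrable (fun t => γ' t / (γ t - q)) MeasureTheory.volume a b := by
  have hcont : Continuous γ := continuous_iff_continuousAt.2 fun t => (hγ t).continuousAt
  apply ContinuousOn.intervalIntegrable
  rw [Set.uIcc_of_le hab]
  exact hc.continuousOn.div (by fun_prop) fun t ht => sub_ne_zero.2 (h t ht)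

lemma log_int {γ γ' : ℝ → ℂ} (hγ : ∀ t, HasDerivAt γ (γ' t) t) (hc : Continuous γ')
    {a b : ℝ} (hab : a ≤ b) {q r : ℂ} (h : ∀ t ∈ Set.Icc a b, γ t ∉ segment ℝ q r) :
    (∫ t in a..b, γ' t / (γ t - q)) - (∫ t in a..b, γ' t / (γ t - r)) =
      Complex.log ((γ b - q) / (γ b - r)) - Complex.log ((γ a - q) / (γ a - r)) := by
  have hq : ∀ t ∈ Set.Icc a b, γ t ≠ q := fun t ht e =>
    h t ht (e ▸ left_mem_segment ℝ _ _)
  have hr : ∀ t ∈ Set.Icc a b, γ t ≠ r := fun t ht e =>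
    h t ht (e ▸ right_mem_segment ℝ _ _)
  rw [← intervalIntegral.integral_sub (int_ok hγ hc hab hq) (int_ok hγ hc hab hr)]
  apply intervalIntegral.integral_eq_sub_of_hasDerivAt
    (f := fun t => Complex.log ((γ t - q) / (γ t - r)))
  · intro t ht
    rw [Set.uIcc_of_le hab] at ht
    have h1 := sub_ne_zero.2 (hq t ht)
    have h2 := sub_ne_zero.2 (hr t ht)
    have := (((hγ t).sub_const q).div ((hγ t).sub_const r) h2).clog_real (mem_slit (h t ht))
    have e : γ' t / (γ t - q) - γ' t / (γ t - r) =
        (γ' t * (γ t - r) - (γ t - q) * γ' t) / (γ t - r) ^ 2 / ((γ t - q) / (γ t - r)) := by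
      field_simp
      try ring
    rw [e]
    exact this
  · exact (int_ok hγ hc hab hq).sub (int_ok hγ hc hab hr)

lemma log_four_aux {X Y Z W : ℂ} (hX : X ≠ 0) (hY : Y ≠ 0) (hZ : Z ≠ 0) (hW : W ≠ 0)
    (h : X * Y = Z * W) : ∃ n : ℤ, Complex.log X + Complex.log Y - Complex.log Z - Complex.log W
      = n * (2 * Real.pi * Complex.I) := by
  rw [← Complex.exp_eq_one_iff, Complex.exp_sub, Complex.exp_sub, Complex.exp_add,
    Complex.exp_log hX, Complex.exp_log hY, Complex.exp_log hZ, Complex.exp_log hW, h]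
  field_simp

lemma log_four_re {X Y Z W : ℂ} (hX : 0 < X.re) (hY : 0 < Y.re) (hZ : 0 < Z.re) (hW : 0 < W.re)
    (h : X * Y = Z * W) :
    Complex.log X + Complex.log Y - Complex.log Z - Complex.log W = 0 := by
  have ne : ∀ V : ℂ, 0 < V.re → V ≠ 0 := by rintro V hV rfl; simp at hV
  obtain ⟨n, hn⟩ := log_four_aux (ne X hX) (ne Y hY) (ne Z hZ) (ne W hW) h
  have him := congrArg Complex.im hn
  simp only [Complex.sub_im, Complex.add_im, Complex.log_im] at him
  have e : ((n:ℂ) * (2 * Real.pi * Complex.I)).im = n * (2 * Real.pi) := by simp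
  rw [e] at him
  have b : ∀ V : ℂ, 0 < V.re → |V.arg| < Real.pi / 2 := fun V hV =>
    Complex.abs_arg_lt_pi_div_two_iff.2 (Or.inl hV)
  have bX := abs_lt.1 (b X hX)
  have bY := abs_lt.1 (b Y hY)
  have bZ := abs_lt.1 (b Z hZ)
  have bW := abs_lt.1 (b W hW)
  have h1 : (n:ℝ) < 1 := by
    by_contra hcon
    push Not at hcon
    nlinarith [Real.pi_pos]
  have h2 : (-1:ℝ) < n := by
    by_contra hcon
    push Not at hcon
    nlinarith [Real.pi_pos]
  have : n = 0 := by
    have h1' : n < 1 := by exact_mod_cast h1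
    have h2' : -1 < n := by exact_mod_cast h2
    omega
  rw [hn, this]; simp

lemma log_four_im {X Y Z W : ℂ} (hX : 0 < X.im) (hY : 0 < Y.im) (hZ : Z.im < 0) (hW : W.im < 0)
    (h : X * Y = Z * W) :
    Complex.log X + Complex.log Y - Complex.log Z - Complex.log W = 2 * Real.pi * Complex.I := by
  have ne : ∀ V : ℂ, V.im ≠ 0 → V ≠ 0 := by rintro V hV rfl; simp at hV
  obtain ⟨n, hn⟩ := log_four_aux (ne X hX.ne') (ne Y hY.ne') (ne Z hZ.ne) (ne W hW.ne) h
  have him := congrArg Complex.im hn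
  simp only [Complex.sub_im, Complex.add_im, Complex.log_im] at him
  have e : ((n:ℂ) * (2 * Real.pi * Complex.I)).im = n * (2 * Real.pi) := by simp
  rw [e] at him
  have bp : ∀ V : ℂ, 0 < V.im → 0 < V.arg ∧ V.arg < Real.pi := fun V hV => by
    refine ⟨lt_of_le_of_ne (Complex.arg_nonneg_iff.2 hV.le) fun h0 => ?_,
      lt_of_le_of_ne (Complex.arg_le_pi V) fun h0 => ?_⟩
    · exact hV.ne' (Complex.arg_eq_zero_iff.1 h0.symm).2
    · exact hV.ne' (Complex.arg_eq_pi_iff.1 h0).2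
  have bn : ∀ V : ℂ, V.im < 0 → -Real.pi < V.arg ∧ V.arg < 0 := fun V hV =>
    ⟨Complex.neg_pi_lt_arg V, Complex.arg_neg_iff.2 hV⟩
  have bX := bp X hX
  have bY := bp Y hY
  have bZ := bn Z hZ
  have bW := bn W hW
  have h1 : (n:ℝ) < 2 := by
    by_contra hcon
    push Not at hcon
    nlinarith [Real.pi_pos]
  have h2 : (0:ℝ) < n := by
    by_contra hcon
    push Not at hcon
    nlinarith [Real.pi_pos]
  have : n = 1 := by
    have h1' : n < 2 := by exact_mod_cast h1
    have h2' : 0 < n := by exact_mod_cast h2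
    omega
  rw [hn, this]; simp

lemma int_eq {γ γ' : ℝ → ℂ} (hγ : ∀ t, HasDerivAt γ (γ' t) t) (hc : Continuous γ')
    {a b : ℝ} (hab : a ≤ b) (hcl : γ a = γ b) {q r : ℂ}
    (h : ∀ t ∈ Set.Icc a b, γ t ∉ segment ℝ q r) :
    (∫ t in a..b, γ' t / (γ t - q)) = (∫ t in a..b, γ' t / (γ t - r)) := by
  have := log_int hγ hc hab h
  rw [hcl, sub_self] at this
  exact sub_eq_zero.1 this

lemma jump_alg {γ γ' : ℝ → ℂ} (hγ : ∀ t, HasDerivAt γ (γ' t) t) (hc : Continuous γ')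
    {a b t₀ : ℝ} (hat : a ≤ t₀) (htb : t₀ ≤ b) (hcl : γ a = γ b) {q₁ q₂ r r' : ℂ}
    (h1 : ∀ t ∈ Set.Icc a t₀, γ t ∉ segment ℝ q₁ r)
    (h2 : ∀ t ∈ Set.Icc a t₀, γ t ∉ segment ℝ r q₂)
    (h3 : ∀ t ∈ Set.Icc t₀ b, γ t ∉ segment ℝ q₁ r')
    (h4 : ∀ t ∈ Set.Icc t₀ b, γ t ∉ segment ℝ r' q₂)
    (hX : 0 < ((γ t₀ - q₁) / (γ t₀ - r)).im) (hY : 0 < ((γ t₀ - r) / (γ t₀ - q₂)).im)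
    (hZ : ((γ t₀ - q₁) / (γ t₀ - r')).im < 0) (hW : ((γ t₀ - r') / (γ t₀ - q₂)).im < 0)
    (hA1 : 0 < ((γ a - q₁) / (γ a - r)).re) (hA2 : 0 < ((γ a - r) / (γ a - q₂)).re)
    (hA3 : 0 < ((γ a - q₁) / (γ a - r')).re) (hA4 : 0 < ((γ a - r') / (γ a - q₂)).re) :
    (∫ t in a..b, γ' t / (γ t - q₁)) - (∫ t in a..b, γ' t / (γ t - q₂)) =
      2 * Real.pi * Complex.I := by
  have ne1 : ∀ {c d : ℝ} {x y : ℂ}, (∀ t ∈ Set.Icc c d, γ t ∉ segment ℝ x y) →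
      ∀ t ∈ Set.Icc c d, γ t ≠ x := fun h t ht e => h t ht (e ▸ left_mem_segment ℝ _ _)
  have ne2 : ∀ {c d : ℝ} {x y : ℂ}, (∀ t ∈ Set.Icc c d, γ t ∉ segment ℝ x y) →
      ∀ t ∈ Set.Icc c d, γ t ≠ y := fun h t ht e => h t ht (e ▸ right_mem_segment ℝ _ _)
  have s1 := intervalIntegral.integral_add_adjacent_intervals
    (int_ok hγ hc hat (ne1 h1)) (int_ok hγ hc htb (ne1 h3))
  have s2 := intervalIntegral.integral_add_adjacent_intervals
    (int_ok hγ hc hat (ne2 h2)) (int_ok hγ hc htb (ne2 h4))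
  have l1 := log_int hγ hc hat h1
  have l2 := log_int hγ hc hat h2
  have l3 := log_int hγ hc htb h3
  have l4 := log_int hγ hc htb h4
  rw [← hcl] at l3 l4
  have n0 : ∀ {z q s : ℂ}, z - q ≠ 0 → (s - z) * ((z - q)) = (s - z) * (z - q) := fun _ => rfl
  have tele : ∀ z : ℂ, z ≠ r → z ≠ r' →
      (z - q₁) / (z - r) * ((z - r) / (z - q₂)) = (z - q₁) / (z - r') * ((z - r') / (z - q₂)) := by
    intro z hz hz'
    rw [div_mul_div_cancel₀ (sub_ne_zero.2 hz), div_mul_div_cancel₀ (sub_ne_zero.2 hz')]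
  have e1 := log_four_im hX hY hZ hW (tele _ (ne2 h1 t₀ ⟨hat, le_rfl⟩) (ne2 h3 t₀ ⟨le_rfl, htb⟩))
  have e2 := log_four_re hA1 hA2 hA3 hA4 (tele _ (ne2 h1 a ⟨le_rfl, hat⟩)
    (hcl ▸ ne2 h3 b ⟨htb, le_rfl⟩))
  linear_combination l1 + l2 + l3 + l4 + e1 - e2 - s1 + s2

open Filter Topology in
lemma ratio_lim {γ γ' : ℝ → ℂ} (hγ : ∀ t, HasDerivAt γ (γ' t) t) {u₁ u₂ σ₁ σ₂ : ℝ}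
    {p : ℂ} (h1 : γ u₁ = p) (h2 : γ u₂ = p) (hσ₂ : σ₂ ≠ 0) (hv : γ' u₂ ≠ 0) :
    Tendsto (fun ε : ℝ => (p - γ (u₁ + σ₁ * ε)) / (p - γ (u₂ + σ₂ * ε))) (𝓝[>] 0)
      (𝓝 ((σ₁ * γ' u₁) / (σ₂ * γ' u₂))) := by
  have key : ∀ u σ : ℝ, γ u = p →
      Tendsto (fun ε : ℝ => ((ε⁻¹ : ℝ) : ℂ) * (γ (u + σ * ε) - p)) (𝓝[>] 0) (𝓝 (σ * γ' u)) := by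
    intro u σ hu
    have e : HasDerivAt (fun τ : ℝ => u + σ * τ) σ 0 := by
      simpa using ((hasDerivAt_id (0:ℝ)).const_mul σ).const_add u
    have d := HasDerivAt.scomp (0:ℝ) (h := fun τ : ℝ => u + σ * τ) (hγ (u + σ * 0)) e
    have d' := hasDerivAt_iff_tendsto_slope.1 d
    have d'' := d'.mono_left (nhdsWithin_mono _ (fun x (hx : 0 < x) => hx.ne') :
      𝓝[>] (0:ℝ) ≤ 𝓝[≠] 0)
    refine (d''.congr fun ε => ?_).trans_eq (by simp)
    simp [slope, hu]
  have := (key u₁ σ₁ h1).div (key u₂ σ₂ h2) (mul_ne_zero (by exact_mod_cast hσ₂) hv)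
  refine this.congr' ?_
  filter_upwards [self_mem_nhdsWithin] with ε (hε : 0 < ε)
  have hε' : ((ε⁻¹ : ℝ) : ℂ) ≠ 0 := by exact_mod_cast (inv_pos.2 hε).ne'
  simp only [Pi.div_apply]
  rw [mul_div_mul_left _ _ hε', ← neg_div_neg_eq, neg_sub, neg_sub]

lemma im_div_formula {σ₁ σ₂ : ℝ} (hσ₂ : σ₂ * σ₂ = 1) (v w : ℂ) (hw : w ≠ 0) :
    ((σ₁ * v) / (σ₂ * w)).im = -(σ₁ * σ₂ * (v.re * w.im - v.im * w.re)) / Complex.normSq w := by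
  have hn : Complex.normSq w ≠ 0 := by simpa using hw
  have h2 : σ₂ ≠ 0 := by rintro rfl; simp at hσ₂
  have : (σ₁ * v) / (σ₂ * w) = ((σ₁ * σ₂ : ℝ) : ℂ) * (v / w) := by
    have : (σ₂ : ℂ) * σ₂ = 1 := by exact_mod_cast hσ₂
    have h2' : (σ₂ : ℂ) ≠ 0 := by exact_mod_cast h2
    push_cast
    field_simp
    linear_combination (-σ₁ * v : ℂ) * this
  rw [this, Complex.im_ofReal_mul, Complex.div_im]
  field_simp
  ring

open Filter Topology in
lemma ratio_im {γ γ' : ℝ → ℂ} (hγ : ∀ t, HasDerivAt γ (γ' t) t) {u₁ u₂ σ₁ σ₂ : ℝ}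
    {p : ℂ} (h1 : γ u₁ = p) (h2 : γ u₂ = p) (hσ₂ : σ₂ * σ₂ = 1) (hv : γ' u₂ ≠ 0) :
    (σ₁ * σ₂ * ((γ' u₁).re * (γ' u₂).im - (γ' u₁).im * (γ' u₂).re) < 0 →
    ∀ᶠ ε in 𝓝[>] (0:ℝ), 0 < ((p - γ (u₁ + σ₁ * ε)) / (p - γ (u₂ + σ₂ * ε))).im) ∧
    (0 < σ₁ * σ₂ * ((γ' u₁).re * (γ' u₂).im - (γ' u₁).im * (γ' u₂).re) →
    ∀ᶠ ε in 𝓝[>] (0:ℝ), ((p - γ (u₁ + σ₁ * ε)) / (p - γ (u₂ + σ₂ * ε))).im < 0) := by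
  have hσ : σ₂ ≠ 0 := by rintro rfl; simp at hσ₂
  have l := (Complex.continuous_im.tendsto _).comp (ratio_lim (σ₁ := σ₁) hγ h1 h2 hσ hv)
  rw [im_div_formula hσ₂ _ _ hv] at l
  have hn : 0 < Complex.normSq (γ' u₂) := by simpa [Complex.normSq_pos] using hv
  constructor
  · intro h
    exact l.eventually (lt_mem_nhds (div_pos (by linarith) hn))
  · intro h
    exact l.eventually (gt_mem_nhds (div_neg_of_neg_of_pos (by linarith) hn))

open Filter Topology in
lemma ratio_re {γ : ℝ → ℂ} (hγ : Continuous γ) {u₁ u₂ σ₁ σ₂ : ℝ}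
    {p A : ℂ} (h1 : γ u₁ = p) (h2 : γ u₂ = p) (hA : A ≠ p) :
    ∀ᶠ ε in 𝓝[>] (0:ℝ), 0 < ((A - γ (u₁ + σ₁ * ε)) / (A - γ (u₂ + σ₂ * ε))).re := by
  have key : ∀ u σ : ℝ, γ u = p →
      Tendsto (fun ε : ℝ => A - γ (u + σ * ε)) (𝓝 0) (𝓝 (A - p)) := by
    intro u σ hu
    have : Continuous (fun ε => A - γ (u + σ * ε)) := by fun_prop
    have h := this.tendsto 0
    simpa only [mul_zero, add_zero, hu] using h
  have hA' := sub_ne_zero.2 hA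
  have l := (Complex.continuous_re.tendsto _).comp ((key u₁ σ₁ h1).div (key u₂ σ₂ h2) hA')
  rw [div_self hA'] at l
  exact nhdsWithin_le_nhds (l.eventually (lt_mem_nhds (by simp)))

open Filter Topology in
lemma jump {γ γ' : ℝ → ℂ} (hγ : ∀ t, HasDerivAt γ (γ' t) t) (hc : Continuous γ')
    {a b t₀ s : ℝ} (hat : a < t₀) (htb : t₀ < b) (hcl : γ a = γ b) (hs : s ∉ Set.Icc a b)
    (hst : γ t₀ = γ s) (huniq : ∀ t ∈ Set.Icc a b, γ t = γ s → t = t₀)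
    (hD : (γ' s).re * (γ' t₀).im - (γ' s).im * (γ' t₀).re ≠ 0) :
    ∀ᶠ ε in 𝓝[>] (0:ℝ),
      Complex.exp ((∫ t in a..b, γ' t / (γ t - γ (s + ε))) / 2) =
      - Complex.exp ((∫ t in a..b, γ' t / (γ t - γ (s - ε))) / 2) := by
  have hcont : Continuous γ := continuous_iff_continuousAt.2 fun t => (hγ t).continuousAt
  have hvs : γ' s ≠ 0 := by intro h; simp [h] at hD
  have hvt : γ' t₀ ≠ 0 := by intro h; simp [h] at hD
  have hA : γ a ≠ γ s := fun h => hat.ne (huniq a ⟨le_rfl, (hat.trans htb).le⟩ h)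
  have hsn : ∀ᶠ t in 𝓝 s, t ∉ Set.Icc a b := isClosed_Icc.isOpen_compl.mem_nhds hs
  have av : ∀ σ τ : ℝ, ∀ K : Set ℝ, σ * σ = 1 → τ * τ = 1 → IsCompact K → K ⊆ Set.Icc a b →
      (∀ t ∈ K, τ * (t - t₀) ≤ 0) →
      ∀ᶠ ε in 𝓝[>] (0:ℝ), ∀ t ∈ K, γ t ∉ segment ℝ (γ (s + σ * ε)) (γ (t₀ + τ * ε)) := by
    intro σ τ K hσ hτ hK hKs hKt
    refine avoid hγ hσ hτ (p := γ s) rfl hst hD hK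
      (fun t ht h => Or.inr (huniq t (hKs ht) h)) ?_ (Eventually.of_forall hKt)
    filter_upwards [hsn] with t ht htK
    exact absurd (hKs htK) ht
  have main : ∀ σ : ℝ, σ * σ = 1 →
      σ * ((γ' s).re * (γ' t₀).im - (γ' s).im * (γ' t₀).re) < 0 → ∀ᶠ ε in 𝓝[>] (0:ℝ),
      (∫ t in a..b, γ' t / (γ t - γ (s + σ * ε))) - (∫ t in a..b, γ' t / (γ t - γ (s + -σ * ε)))
        = 2 * Real.pi * Complex.I := by
    intro σ hσ hneg
    have hσ' : -σ * -σ = 1 := by linarith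
    have o : (1:ℝ) * 1 = 1 := by norm_num
    have o' : (-1:ℝ) * -1 = 1 := by norm_num
    have sub1 : Set.Icc a t₀ ⊆ Set.Icc a b := Set.Icc_subset_Icc le_rfl htb.le
    have sub2 : Set.Icc t₀ b ⊆ Set.Icc a b := Set.Icc_subset_Icc hat.le le_rfl
    have c1 : ∀ t ∈ Set.Icc a t₀, (1:ℝ) * (t - t₀) ≤ 0 := fun t ht => by linarith [ht.2]
    have c2 : ∀ t ∈ Set.Icc t₀ b, (-1:ℝ) * (t - t₀) ≤ 0 := fun t ht => by linarith [ht.1]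
    filter_upwards [av σ 1 _ hσ o isCompact_Icc sub1 c1, av (-σ) 1 _ hσ' o isCompact_Icc sub1 c1,
      av σ (-1) _ hσ o' isCompact_Icc sub2 c2, av (-σ) (-1) _ hσ' o' isCompact_Icc sub2 c2,
      (ratio_im (σ₁ := σ) (σ₂ := 1) hγ rfl hst o hvt).1 (by linarith),
      (ratio_im (σ₁ := 1) (σ₂ := -σ) hγ hst rfl hσ' hvs).1 (by linarith),
      (ratio_im (σ₁ := σ) (σ₂ := -1) hγ rfl hst o' hvt).2 (by linarith),
      (ratio_im (σ₁ := -1) (σ₂ := -σ) hγ hst rfl hσ' hvs).2 (by linarith),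
      ratio_re (σ₁ := σ) (σ₂ := 1) hcont rfl hst hA,
      ratio_re (σ₁ := 1) (σ₂ := -σ) hcont hst rfl hA,
      ratio_re (σ₁ := σ) (σ₂ := -1) hcont rfl hst hA,
      ratio_re (σ₁ := -1) (σ₂ := -σ) hcont hst rfl hA] with ε h1 h2 h3 h4 hX hY hZ hW A1 A2 A3 A4
    rw [← hst] at hX hY hZ hW
    exact jump_alg hγ hc hat.le htb.le hcl h1 (fun t ht => by rw [segment_symm]; exact h2 t ht) h3
      (fun t ht => by rw [segment_symm]; exact h4 t ht) hX hY hZ hW A1 A2 A3 A4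
  have fin : ∀ x y : ℂ, x - y = 2 * Real.pi * Complex.I →
      Complex.exp (x / 2) = -Complex.exp (y / 2) := by
    intro x y h
    have : x / 2 = y / 2 + Real.pi * Complex.I := by linear_combination h / 2
    rw [this, Complex.exp_add, Complex.exp_pi_mul_I]; ring
  rcases lt_or_gt_of_ne hD with h | h
  · filter_upwards [main 1 (by norm_num) (by linarith)] with ε hε
    have := fin _ _ hε
    simpa [sub_eq_add_neg] using this
  · filter_upwards [main (-1) (by norm_num) (by linarith)] with ε hε
    have := fin _ _ hε
    simp only [neg_neg, one_mul, neg_mul] at this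
    rw [sub_eq_add_neg, this, neg_neg]

open Filter Topology in
lemma glue {u : ℝ → ℂ} {U : Set ℝ} (hU : IsOpen U) (hUc : IsPreconnected U) (E : Finset ℝ)
    (h1 : ∀ x ∈ U, x ∉ E → ∀ᶠ y in 𝓝 x, u y = u x)
    (h2 : ∀ x ∈ U, x ∈ E → ∀ᶠ ε in 𝓝[>] (0:ℝ), u (x + ε) = u (x - ε))
    {x y : ℝ} (hx : x ∈ U) (hxE : x ∉ E) (hy : y ∈ U) (hyE : y ∉ E) : u x = u y := by
  have K : ∀ (f : ℝ → ℂ) (V : Set ℝ), IsOpen V → IsPreconnected V →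
      (∀ x ∈ V, ∀ᶠ y in 𝓝 x, f y = f x) → ∀ x ∈ V, ∀ y ∈ V, f x = f y := by
    intro f V hV hVc h x hx y hy
    have hd : ∀ x ∈ V, HasDerivAt f 0 x := fun x hx =>
      (hasDerivAt_const x (f x)).congr_of_eventuallyEq (h x hx)
    exact hV.is_const_of_deriv_eq_zero hVc
      (fun x hx => (hd x hx).differentiableAt.differentiableWithinAt)
      (fun x hx => (hd x hx).deriv) hx hy
  have hv : ∀ x, ∃ v, x ∈ U → ∀ᶠ y in 𝓝[≠] x, u y = v := by
    intro x
    by_cases hx : x ∈ U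
    swap
    · exact ⟨0, fun h => absurd h hx⟩
    by_cases hxE : x ∈ E
    swap
    · exact ⟨u x, fun _ => nhdsWithin_le_nhds (h1 x hx hxE)⟩
    have hopen : ∀ᶠ y in 𝓝 x, y ∈ U ∧ y ∉ E.erase x :=
      Filter.Eventually.and (hU.mem_nhds hx) ((E.erase x).finite_toSet.isClosed.isOpen_compl.mem_nhds (by simp))
    obtain ⟨δ, hδ, hball⟩ := Metric.eventually_nhds_iff.1 hopen
    have good : ∀ y, |y - x| < δ → y ≠ x → y ∈ U ∧ y ∉ E := by
      intro y hy hne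
      have := hball (y := y) (by rwa [Real.dist_eq])
      exact ⟨this.1, fun h => this.2 (Finset.mem_erase.2 ⟨hne, h⟩)⟩
    have cR := K u (Set.Ioo x (x + δ)) isOpen_Ioo isPreconnected_Ioo (fun y hy => by
      have := good y (by rw [abs_lt]; constructor <;> linarith [hy.1, hy.2]) hy.1.ne'
      exact h1 y this.1 this.2)
    have cL := K u (Set.Ioo (x - δ) x) isOpen_Ioo isPreconnected_Ioo (fun y hy => by
      have := good y (by rw [abs_lt]; constructor <;> linarith [hy.1, hy.2]) hy.2.ne
      exact h1 y this.1 this.2)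
    have hlt : ∀ᶠ ε in 𝓝[>] (0:ℝ), ε < δ := nhdsWithin_le_nhds (gt_mem_nhds hδ)
    obtain ⟨ε, ⟨he, hεδ⟩, hε0 : 0 < ε⟩ :=
      (((h2 x hx hxE).and hlt).and self_mem_nhdsWithin).exists
    refine ⟨u (x + ε), fun _ => ?_⟩
    rw [eventually_nhdsWithin_iff]
    filter_upwards [Ioo_mem_nhds (show x - δ < x by linarith) (show x < x + δ by linarith)]
      with y hy hne
    rcases lt_or_gt_of_ne (show y ≠ x from hne) with h | h
    · rw [he]
      exact cL y ⟨hy.1, h⟩ (x - ε) ⟨by linarith, by linarith⟩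
    · exact cR y ⟨h, hy.2⟩ (x + ε) ⟨by linarith, by linarith⟩
  choose v hv using hv
  have huniq : ∀ x ∈ U, ∀ c, (∀ᶠ y in 𝓝[≠] x, u y = c) → v x = c := by
    intro x hx c h
    obtain ⟨y, h1, h2⟩ := ((hv x hx).and h).exists
    rw [← h1, h2]
  have hvu : ∀ x ∈ U, x ∉ E → v x = u x := fun x hx hxE =>
    huniq x hx _ (nhdsWithin_le_nhds (h1 x hx hxE))
  have hloc : ∀ x ∈ U, ∀ᶠ y in 𝓝 x, v y = v x := by
    intro x hx
    have := eventually_eventually_nhdsWithin.2 (hv x hx)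
    rw [eventually_nhdsWithin_iff] at this
    filter_upwards [this, hU.mem_nhds hx] with y hy hyU
    by_cases hyx : y = x
    · rw [hyx]
    · have h := hy hyx
      rw [isOpen_compl_singleton.nhdsWithin_eq hyx] at h
      exact huniq y hyU _ (nhdsWithin_le_nhds h)
  rw [← hvu x hx hxE, ← hvu y hy hyE]
  exact K v U hU hUc hloc x hx y hy

lemma far_zero {γ γ' : ℝ → ℂ} (hγ : ∀ t, HasDerivAt γ (γ' t) t) (hc : Continuous γ')
    {a b : ℝ} (hab : a ≤ b) (hcl : γ a = γ b) {q : ℂ} (h : ∀ t ∈ Set.Icc a b, ‖γ t‖ < ‖q‖) :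
    (∫ t in a..b, γ' t / (γ t - q)) = 0 := by
  have hne : ∀ t ∈ Set.Icc a b, γ t ≠ q := fun t ht e => (h t ht).ne (by rw [e])
  have := intervalIntegral.integral_eq_sub_of_hasDerivAt (a := a) (b := b)
    (f := fun t => Complex.log (1 - γ t / q)) (f' := fun t => γ' t / (γ t - q)) ?_
    (int_ok hγ hc hab hne)
  · rw [this, hcl, sub_self]
  · intro t ht
    rw [Set.uIcc_of_le hab] at ht
    have hq : 0 < ‖q‖ := (norm_nonneg _).trans_lt (h t ht)
    have hq0 : q ≠ 0 := norm_pos_iff.1 hq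
    have hs : 1 - γ t / q ∈ Complex.slitPlane := by
      left
      have h1 : ‖γ t / q‖ < 1 := by rw [norm_div, div_lt_one hq]; exact h t ht
      have h2 := (Complex.re_le_norm (γ t / q))
      simp only [Complex.sub_re, Complex.one_re]
      linarith
    have := (((hγ t).div_const q).const_sub 1).clog_real hs
    have n1 := sub_ne_zero.2 (hne t ht)
    have n2 : 1 - γ t / q ≠ 0 := Complex.slitPlane_ne_zero hs
    have n3 : q - γ t ≠ 0 := sub_ne_zero.2 (hne t ht).symm
    have e : γ' t / (γ t - q) = -(γ' t / q) / (1 - γ t / q) := by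
      rw [div_eq_div_iff n1 n2]
      field_simp
      ring
    rw [e]
    exact this

open Filter Topology in
theorem crossing_even {γ γ' : ℝ → ℂ} (hγ : ∀ t, HasDerivAt γ (γ' t) t) (hc : Continuous γ')
    (hbot : Tendsto (fun t => ‖γ t‖) atBot atTop) (htop : Tendsto (fun t => ‖γ t‖) atTop atTop)
    {a b : ℝ} (hab : a < b) (hcl : γ a = γ b)
    (hD : (γ' a).re * (γ' b).im - (γ' a).im * (γ' b).re ≠ 0)
    (hp : ∀ t ∈ Set.Icc a b, γ t = γ a → t = a ∨ t = b)
    (C : Finset ℝ) (hC : ∀ s, s ∈ C ↔ s ∉ Set.Icc a b ∧ ∃ t ∈ Set.Icc a b, γ t = γ s)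
    (hcross : ∀ s ∈ C, ∃ t₀, a < t₀ ∧ t₀ < b ∧ γ t₀ = γ s ∧
      (∀ t ∈ Set.Icc a b, γ t = γ s → t = t₀) ∧
      (γ' s).re * (γ' t₀).im - (γ' s).im * (γ' t₀).re ≠ 0) : Even C.card := by
  have hcont : Continuous γ := continuous_iff_continuousAt.2 fun t => (hγ t).continuousAt
  set w : ℝ → ℂ := fun s => ∫ t in a..b, γ' t / (γ t - γ s) with hw
  set N : ℝ → ℕ := fun s => (C.filter (· < s)).card with hN
  set u : ℝ → ℂ := fun s => Complex.exp (w s / 2) * (-1) ^ N s with hu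
  have hKc : IsCompact (γ '' Set.Icc a b) := isCompact_Icc.image hcont
  have loc : ∀ x, x ∉ Set.Icc a b → x ∉ C → ∀ᶠ y in 𝓝 x, u y = u x := by
    intro x hx hxC
    have hxn : γ x ∈ (γ '' Set.Icc a b)ᶜ := by
      rintro ⟨t, ht, h⟩
      exact hxC ((hC x).2 ⟨hx, t, ht, h⟩)
    obtain ⟨η, hη, hball⟩ := Metric.isOpen_iff.1 hKc.isClosed.isOpen_compl _ hxn
    have hcnt : ∀ᶠ y in 𝓝 x, ∀ c ∈ C, (c < y ↔ c < x) := by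
      rw [Filter.eventually_all_finset]
      intro c hcC
      have : c ≠ x := fun h => hxC (h ▸ hcC)
      rcases lt_or_gt_of_ne this with h | h
      · filter_upwards [lt_mem_nhds h] with y hy
        exact ⟨fun _ => h, fun _ => hy⟩
      · filter_upwards [gt_mem_nhds h] with y hy
        exact ⟨fun h' => absurd h' hy.not_gt, fun h' => absurd h' h.not_gt⟩
    filter_upwards [hcnt, hcont.continuousAt.eventually (Metric.ball_mem_nhds (γ x) hη)]
      with y hy hyb
    have e1 : w y = w x := by
      apply int_eq hγ hc hab.le hcl
      intro t ht hseg
      exact hball ((convex_ball (γ x) η).segment_subset hyb (Metric.mem_ball_self hη) hseg)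
        ⟨t, ht, rfl⟩
    have e2 : N y = N x := by
      simp only [hN]
      rw [Finset.filter_congr hy]
    simp only [hu, e1, e2]
  have jmp : ∀ x ∈ C, ∀ᶠ ε in 𝓝[>] (0:ℝ), u (x + ε) = u (x - ε) := by
    intro x hx
    obtain ⟨t₀, h1, h2, h3, h4, h5⟩ := hcross x hx
    have hcnt : ∀ᶠ ε in 𝓝[>] (0:ℝ), ∀ c ∈ C, (c < x + ε ↔ (c < x - ε ∨ c = x)) := by
      rw [Filter.eventually_all_finset]
      intro c hcC
      rcases lt_trichotomy c x with h | h | h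
      · filter_upwards [nhdsWithin_le_nhds (gt_mem_nhds (sub_pos.2 h)), self_mem_nhdsWithin]
          with ε hε (hε0 : 0 < ε)
        exact ⟨fun _ => Or.inl (by linarith), fun _ => by linarith⟩
      · filter_upwards [self_mem_nhdsWithin] with ε (hε0 : 0 < ε)
        exact ⟨fun _ => Or.inr h, fun _ => by linarith⟩
      · filter_upwards [nhdsWithin_le_nhds (gt_mem_nhds (sub_pos.2 h)), self_mem_nhdsWithin]
          with ε hε (hε0 : 0 < ε)
        refine ⟨fun _ => by linarith, ?_⟩
        rintro (h' | h') <;> linarith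
    filter_upwards [jump hγ hc h1 h2 hcl ((hC x).1 hx).1 h3 h4 h5, hcnt, self_mem_nhdsWithin]
      with ε hj hε (hε0 : 0 < ε)
    have e2 : N (x + ε) = N (x - ε) + 1 := by
      simp only [hN]
      rw [Finset.filter_congr hε, Finset.filter_or, Finset.card_union_of_disjoint,
        Finset.filter_eq' C x, if_pos hx, Finset.card_singleton]
      rw [Finset.disjoint_filter]
      rintro c _ h rfl
      linarith
    simp only [hu, e2, hw] at hj ⊢
    rw [hj, pow_succ]
    ring
  obtain ⟨M, hM⟩ := hKc.isBounded.exists_norm_le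
  have hM' : ∀ t ∈ Set.Icc a b, ‖γ t‖ ≤ M := fun t ht => hM _ ⟨t, ht, rfl⟩
  have far : ∀ s, M < ‖γ s‖ → w s = 0 := fun s hs =>
    far_zero hγ hc hab.le hcl fun t ht => (hM' t ht).trans_lt hs
  have farC : ∀ s, M < ‖γ s‖ → s ∉ C := by
    intro s hs h
    obtain ⟨_, t, ht, he⟩ := (hC s).1 h
    have := hM' t ht
    rw [he] at this
    linarith
  have Cab : ∀ c ∈ C, c < a ∨ b < c := by
    intro c hcC
    have := ((hC c).1 hcC).1
    by_contra hcon
    push Not at hcon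
    exact this hcon
  have left : ∀ x, x < a → x ∉ C → u x = 1 := by
    intro x hx hxC
    have hev : ∀ᶠ s in atBot, ∀ c ∈ C, s < c := by
      rw [Filter.eventually_all_finset]
      intro c _
      exact eventually_lt_atBot c
    obtain ⟨s, ⟨hs1, hs2⟩, hs3⟩ := (((hbot.eventually (eventually_gt_atTop M)).and
      (eventually_lt_atBot a)).and hev).exists
    rw [glue (isOpen_Iio (a := a)) isPreconnected_Iio C
      (fun y hy hyC => loc y (fun h => absurd h.1 (not_le.2 hy)) hyC) (fun y _ hyC => jmp y hyC)
      hx hxC hs2 (farC s hs1)]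
    have : N s = 0 := by
      simp only [hN, Finset.card_eq_zero, Finset.filter_eq_empty_iff]
      intro c hcC
      exact (hs3 c hcC).not_gt
    simp [hu, this, far s hs1]
  have right : ∀ x, b < x → x ∉ C → u x = (-1) ^ C.card := by
    intro x hx hxC
    have hev : ∀ᶠ s in atTop, ∀ c ∈ C, c < s := by
      rw [Filter.eventually_all_finset]
      intro c _
      exact eventually_gt_atTop c
    obtain ⟨s, ⟨hs1, hs2⟩, hs3⟩ := (((htop.eventually (eventually_gt_atTop M)).and
      (eventually_gt_atTop b)).and hev).exists
    rw [glue (isOpen_Ioi (a := b)) isPreconnected_Ioi C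
      (fun y hy hyC => loc y (fun h => absurd h.2 (not_le.2 hy)) hyC) (fun y _ hyC => jmp y hyC)
      hx hxC hs2 (farC s hs1)]
    have : N s = C.card := by
      simp only [hN]
      rw [Finset.filter_true_of_mem hs3]
    simp [hu, this, far s hs1]
  have corner := avoid (σ₁ := -1) (σ₂ := 1) hγ (by norm_num) (by norm_num) (p := γ a) rfl hcl.symm
    hD isCompact_Icc hp (Eventually.of_forall fun t ht => by linarith [ht.1])
    (Eventually.of_forall fun t ht => by linarith [ht.2])
  have hcnt : ∀ᶠ ε in 𝓝[>] (0:ℝ), ∀ c ∈ C, (c < a - ε ∧ c < b + ε) ∨ (a - ε < c ∧ b + ε < c) := by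
    rw [Filter.eventually_all_finset]
    intro c hcC
    rcases Cab c hcC with h | h
    · filter_upwards [nhdsWithin_le_nhds (gt_mem_nhds (sub_pos.2 h)), self_mem_nhdsWithin]
        with ε hε (hε0 : 0 < ε)
      left; constructor <;> linarith
    · filter_upwards [nhdsWithin_le_nhds (gt_mem_nhds (sub_pos.2 h)), self_mem_nhdsWithin]
        with ε hε (hε0 : 0 < ε)
      right; constructor <;> linarith
  obtain ⟨ε, ⟨h1, h2⟩, hε : 0 < ε⟩ := ((corner.and hcnt).and self_mem_nhdsWithin).exists
  have e1 : w (a - ε) = w (b + ε) := by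
    have := int_eq hγ hc hab.le hcl h1
    simpa [hw, sub_eq_add_neg] using this
  have e2 : N (a - ε) = N (b + ε) := by
    simp only [hN]
    congr 1
    apply Finset.filter_congr
    intro c hcC
    rcases h2 c hcC with h | h
    · exact ⟨fun _ => h.2, fun _ => h.1⟩
    · exact ⟨fun h' => absurd h' h.1.not_gt, fun h' => absurd h' h.2.not_gt⟩
  have nC1 : a - ε ∉ C := fun h => by rcases h2 _ h with h | h <;> linarith [h.1]
  have nC2 : b + ε ∉ C := fun h => by rcases h2 _ h with h | h <;> linarith [h.2]
  have l := left (a - ε) (by linarith) nC1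
  have r := right (b + ε) (by linarith) nC2
  have e3 : u (a - ε) = u (b + ε) := by simp only [hu, e1, e2]
  rw [l, r] at e3
  by_contra hodd
  rw [Nat.not_even_iff_odd] at hodd
  rw [hodd.neg_one_pow] at e3
  norm_num at e3

lemma even_card_invol (F : Finset ℝ) (σ : ℝ → ℝ) (h1 : ∀ x ∈ F, σ x ∈ F) (h2 : ∀ x ∈ F, σ x ≠ x)
    (h3 : ∀ x ∈ F, σ (σ x) = x) : Even F.card := by
  have := Finset.prod_involution (s := F) (f := fun _ => (-1 : ℤ)) (fun x _ => σ x)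
    (fun _ _ => by norm_num) (fun x hx _ => h2 x hx) h1 h3
  rw [Finset.prod_const] at this
  by_contra hodd
  rw [Nat.not_even_iff_odd] at hodd
  rw [hodd.neg_one_pow] at this
  norm_num at this

open Filter in
lemma parity_aux (f g : Polynomial ℝ) (n : ℕ)
    (α : ℝ → ℝ × ℝ) (hα : ∀ t : ℝ, α t = (f.eval t, g.eval t))
    (hreg : ∀ t : ℝ, ((Polynomial.derivative f).eval t, (Polynomial.derivative g).eval t)
      ≠ (0, 0))
    (S : Set (ℝ × ℝ)) (hSdef : S = {P : ℝ × ℝ | Set.Nontrivial (α ⁻¹' {P})})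
    (htwo : ∀ P ∈ S, (α ⁻¹' {P}).ncard = 2)
    (hnode : ∀ P ∈ S, ∀ s s' : ℝ, s ≠ s' → α s = P → α s' = P →
      (Polynomial.derivative f).eval s * (Polynomial.derivative g).eval s' -
        (Polynomial.derivative f).eval s' * (Polynomial.derivative g).eval s ≠ 0)
    (t : Fin (2 * n) → ℝ) (ht : StrictMono t) (htrange : Set.range t = α ⁻¹' S)
    (a b : Fin (2 * n)) (hab : a < b) (heq : α (t a) = α (t b)) :
    Odd ((a : ℕ) + (b : ℕ)) := by
  have memS : ∀ x y, x ≠ y → α x = α y → α x ∈ S := by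
    intro x y hxy h
    rw [hSdef]
    exact ⟨x, rfl, y, h.symm, hxy⟩
  have three : ∀ x y z, x ≠ y → α x = α y → α z = α x → z = x ∨ z = y := by
    intro x y z hxy h hz
    obtain ⟨p, q, hpq, he⟩ := Set.ncard_eq_two.1 (htwo _ (memS x y hxy h))
    have hx : x ∈ ({p, q} : Set ℝ) := by rw [← he]; rfl
    have hy : y ∈ ({p, q} : Set ℝ) := by rw [← he]; exact h.symm
    have hz' : z ∈ ({p, q} : Set ℝ) := by rw [← he]; exact hz
    simp only [Set.mem_insert_iff, Set.mem_singleton_iff] at hx hy hz'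
    grind
  set T : Finset ℝ := Finset.univ.image t with hT
  have memT : ∀ x, x ∈ T ↔ ∃ y, y ≠ x ∧ α y = α x := by
    intro x
    have : x ∈ T ↔ x ∈ Set.range t := by simp [hT]
    rw [this, htrange, Set.mem_preimage]
    constructor
    · intro h
      rw [hSdef] at h
      obtain ⟨y, hy, hne⟩ := Set.Nontrivial.exists_ne h x
      exact ⟨y, hne, hy⟩
    · rintro ⟨y, hne, hy⟩
      exact memS x y hne.symm hy.symm
  have hσ : ∀ x, ∃ y, x ∈ T → y ≠ x ∧ α y = α x := by
    intro x
    by_cases hx : x ∈ T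
    · obtain ⟨y, hy⟩ := (memT x).1 hx
      exact ⟨y, fun _ => hy⟩
    · exact ⟨0, fun h => absurd h hx⟩
  choose σ hσ using hσ
  have σT : ∀ x ∈ T, σ x ∈ T := fun x hx =>
    (memT _).2 ⟨x, (hσ x hx).1.symm, (hσ x hx).2.symm⟩
  have σu : ∀ x ∈ T, ∀ y, y ≠ x → α y = α x → y = σ x := by
    intro x hx y hne h
    rcases three x (σ x) y (hσ x hx).1.symm (hσ x hx).2.symm h with h | h
    · exact absurd h hne
    · exact h
  have σσ : ∀ x ∈ T, σ (σ x) = x := fun x hx =>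
    (σu (σ x) (σT x hx) x (hσ x hx).1.symm (hσ x hx).2.symm).symm
  have hAB : t a < t b := ht hab
  have aT : t a ∈ T := by simp [hT]
  have bT : t b ∈ T := by simp [hT]
  have σa : σ (t a) = t b := (σu _ aT _ hAB.ne' heq.symm).symm
  have σb : σ (t b) = t a := (σu _ bT _ hAB.ne heq).symm
  -- the complex curve
  set γ : ℝ → ℂ := fun x => ((f.eval x : ℝ) : ℂ) + ((g.eval x : ℝ) : ℂ) * Complex.I with hγdef
  set γ' : ℝ → ℂ := fun x => (((Polynomial.derivative f).eval x : ℝ) : ℂ) +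
    (((Polynomial.derivative g).eval x : ℝ) : ℂ) * Complex.I with hγ'def
  have γre : ∀ x, (γ x).re = f.eval x := by intro x; simp [hγdef]
  have γim : ∀ x, (γ x).im = g.eval x := by intro x; simp [hγdef]
  have γ're : ∀ x, (γ' x).re = (Polynomial.derivative f).eval x := by intro x; simp [hγ'def]
  have γ'im : ∀ x, (γ' x).im = (Polynomial.derivative g).eval x := by intro x; simp [hγ'def]
  have γα : ∀ x y, γ x = γ y ↔ α x = α y := by
    intro x y
    rw [Complex.ext_iff, hα, hα, Prod.ext_iff, γre, γre, γim, γim]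
  have hγ : ∀ x, HasDerivAt γ (γ' x) x := fun x =>
    ((f.hasDerivAt x).ofReal_comp).add (((g.hasDerivAt x).ofReal_comp).mul_const Complex.I)
  have hc : Continuous γ' := by
    have h1 := (Polynomial.derivative f).continuous
    have h2 := (Polynomial.derivative g).continuous
    simp only [hγ'def]
    fun_prop
  have inf : ∀ l : Filter ℝ, Tendsto (fun x : ℝ => ‖x‖) l atTop →
      Tendsto (fun x => ‖γ x‖) l atTop := by
    intro l hl
    have hdeg : 0 < f.degree ∨ 0 < g.degree := by
      by_contra hcon
      push Not at hcon
      apply hreg 0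
      rw [Polynomial.eq_C_of_degree_le_zero hcon.1, Polynomial.eq_C_of_degree_le_zero hcon.2]
      simp
    rcases hdeg with h | h
    · refine tendsto_atTop_mono (fun x => ?_) (Polynomial.tendsto_norm_atTop f h hl)
      rw [Real.norm_eq_abs, ← γre]
      exact Complex.abs_re_le_norm _
    · refine tendsto_atTop_mono (fun x => ?_) (Polynomial.tendsto_norm_atTop g h hl)
      rw [Real.norm_eq_abs, ← γim]
      exact Complex.abs_im_le_norm _
  have hnode' : ∀ x y, x ≠ y → α x = α y →
      (γ' x).re * (γ' y).im - (γ' x).im * (γ' y).re ≠ 0 := by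
    intro x y hxy h
    rw [γ're, γ're, γ'im, γ'im]
    have := hnode _ (memS x y hxy h) x y hxy rfl h.symm
    contrapose! this
    linarith
  set C := T.filter (fun s => s ∉ Set.Icc (t a) (t b) ∧ σ s ∈ Set.Icc (t a) (t b)) with hCdef
  have notends : ∀ s ∈ T, s ∉ Set.Icc (t a) (t b) → σ s ≠ t a ∧ σ s ≠ t b := by
    intro s hs hn
    constructor
    · intro h
      have := σσ s hs
      rw [h, σa] at this
      exact hn (this ▸ ⟨hAB.le, le_rfl⟩)
    · intro h
      have := σσ s hs
      rw [h, σb] at this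
      exact hn (this ▸ ⟨le_rfl, hAB.le⟩)
  have evC : Even C.card := by
    refine crossing_even hγ hc (inf _ tendsto_abs_atBot_atTop) (inf _ tendsto_abs_atTop_atTop)
      hAB ((γα _ _).2 heq) (hnode' _ _ hAB.ne heq) ?_ C ?_ ?_
    · intro x _ hx
      exact three _ _ x hAB.ne heq ((γα _ _).1 hx)
    · intro s
      simp only [hCdef, Finset.mem_filter]
      constructor
      · rintro ⟨hs, h1, h2⟩
        exact ⟨h1, σ s, h2, (γα _ _).2 (hσ s hs).2⟩
      · rintro ⟨h1, x, hx, he⟩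
        have hne : x ≠ s := by rintro rfl; exact h1 hx
        have he' := (γα _ _).1 he
        have hs : s ∈ T := (memT s).2 ⟨x, hne, he'⟩
        exact ⟨hs, h1, σu s hs x hne he' ▸ hx⟩
    · intro s hs
      simp only [hCdef, Finset.mem_filter] at hs
      obtain ⟨hs, h1, h2⟩ := hs
      obtain ⟨na, nb⟩ := notends s hs h1
      refine ⟨σ s, lt_of_le_of_ne h2.1 na.symm, lt_of_le_of_ne h2.2 nb, (γα _ _).2 (hσ s hs).2,
        ?_, hnode' _ _ (hσ s hs).1.symm (hσ s hs).2.symm⟩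
      intro x hx he
      exact σu s hs x (by rintro rfl; exact h1 hx) ((γα _ _).1 he)
  set D := T.filter (fun s => s ∈ Set.Ioo (t a) (t b)) with hD
  have cardD : D.card = (b : ℕ) - a - 1 := by
    have : D = (Finset.Ioo a b).image t := by
      ext x
      simp only [hD, hT, Finset.mem_filter, Finset.mem_image, Finset.mem_univ, true_and,
        Finset.mem_Ioo, Set.mem_Ioo]
      constructor
      · rintro ⟨⟨i, rfl⟩, h1, h2⟩
        exact ⟨i, ⟨ht.lt_iff_lt.1 h1, ht.lt_iff_lt.1 h2⟩, rfl⟩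
      · rintro ⟨i, ⟨h1, h2⟩, rfl⟩
        exact ⟨⟨i, rfl⟩, ht h1, ht h2⟩
    rw [this, Finset.card_image_of_injective _ ht.injective, Fin.card_Ioo]
  have ev1 : Even (D.filter (fun s => σ s ∈ Set.Ioo (t a) (t b))).card := by
    apply even_card_invol _ σ
    · intro x hx
      simp only [hD, Finset.mem_filter] at hx ⊢
      exact ⟨⟨σT x hx.1.1, hx.2⟩, by rw [σσ x hx.1.1]; exact hx.1.2⟩
    · intro x hx
      simp only [hD, Finset.mem_filter] at hx
      exact (hσ x hx.1.1).1
    · intro x hx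
      simp only [hD, Finset.mem_filter] at hx
      exact σσ x hx.1.1
  have ev2 : (D.filter (fun s => ¬ σ s ∈ Set.Ioo (t a) (t b))).card = C.card := by
    apply Finset.card_bij' (fun x _ => σ x) (fun x _ => σ x)
    · intro x hx
      simp only [hD, hCdef, Finset.mem_filter] at hx ⊢
      obtain ⟨⟨hx, h1⟩, h2⟩ := hx
      refine ⟨σT x hx, fun h => h2 ⟨lt_of_le_of_ne h.1 ?_, lt_of_le_of_ne h.2 ?_⟩, ?_⟩
      · intro h
        have := σσ x hx
        rw [← h, σa] at this
        linarith [h1.2]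
      · intro h
        have := σσ x hx
        rw [h, σb] at this
        linarith [h1.1]
      · rw [σσ x hx]; exact ⟨h1.1.le, h1.2.le⟩
    · intro x hx
      simp only [hD, hCdef, Finset.mem_filter] at hx ⊢
      obtain ⟨hx, h1, h2⟩ := hx
      obtain ⟨na, nb⟩ := notends x hx h1
      refine ⟨⟨σT x hx, lt_of_le_of_ne h2.1 na.symm, lt_of_le_of_ne h2.2 nb⟩, ?_⟩
      rw [σσ x hx]
      exact fun h => h1 ⟨h.1.le, h.2.le⟩
    · intro x hx
      simp only [hD, Finset.mem_filter] at hx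
      exact σσ x hx.1.1
    · intro x hx
      simp only [hCdef, Finset.mem_filter] at hx
      exact σσ x hx.1
  have tot := Finset.card_filter_add_card_filter_not (s := D)
    (fun s => σ s ∈ Set.Ioo (t a) (t b))
  rw [ev2, cardD] at tot
  have hab' : (a : ℕ) < b := hab
  obtain ⟨k, hk⟩ := ev1
  obtain ⟨m, hm⟩ := evC
  rw [hk, hm] at tot
  exact ⟨a + k + m, by omega⟩

theorem parity_property_for_nodal_curves (f g : Polynomial ℝ) (n : ℕ)
    (α : ℝ → ℝ × ℝ) (hα : ∀ t : ℝ, α t = (f.eval t, g.eval t))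
    (hreg : ∀ t : ℝ, ((Polynomial.derivative f).eval t, (Polynomial.derivative g).eval t)
      ≠ (0, 0))
    (S : Set (ℝ × ℝ)) (hSdef : S = {P : ℝ × ℝ | Set.Nontrivial (α ⁻¹' {P})})
    (hSfin : S.Finite) (hScard : S.ncard = n)
    (htwo : ∀ P ∈ S, (α ⁻¹' {P}).ncard = 2)
    (hnode : ∀ P ∈ S, ∀ s s' : ℝ, s ≠ s' → α s = P → α s' = P →
      (Polynomial.derivative f).eval s * (Polynomial.derivative g).eval s' -
        (Polynomial.derivative f).eval s' * (Polynomial.derivative g).eval s ≠ 0)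
    (t : Fin (2 * n) → ℝ) (ht : StrictMono t) (htrange : Set.range t = α ⁻¹' S)
    (a b : Fin (2 * n)) (hab : a ≠ b) (heq : α (t a) = α (t b)) :
    Odd ((a : ℕ) + (b : ℕ)) := by
  rcases lt_or_gt_of_ne hab with h | h
  · exact parity_aux f g n α hα hreg S hSdef htwo hnode t ht htrange a b h heq
  · rw [add_comm]
    exact parity_aux f g n α hα hreg S hSdef htwo hnode t ht htrange b a h heq.symm
end
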